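/- arXiv:2603.26619 — 2 statements merged into one kernel-verified Lean document; each statement's English description precedes it below -/
import Mathlib

section
/- Let p : ℕ → ℝ satisfy p(n) ≥ 0 for all n, suppose the series ∑_{n=0}^∞ p(n) converges to 1, the series ∑_{n=0}^∞ n·p(n) converges to a value K, and the series ∑_{n=0}^∞ −p(n)·log p(n) converges. Then the Shannon entropy H = −∑_{n=0}^∞ p(n)·log p(n) satisfies H ≤ (1+K)·log(1+K) − K·log K (with the convention 0·log 0 = 0). -/
/-- Pointwise form of Gibbs' inequality. -/
theorem neg_mul_log_le_neg_mul_log_add_sub {x y : ℝ} (hx : 0 ≤ x) (hy : 0 < y) :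
    -(x * Real.log x) ≤ -(x * Real.log y) + (y - x) := by
  rcases hx.eq_or_lt with rfl | hx
  · simpa using hy.le
  · have h := mul_le_mul_of_nonneg_left (Real.log_le_sub_one_of_pos (div_pos hy hx)) hx.le
    rw [Real.log_div hy.ne' hx.ne', mul_sub, mul_sub, mul_div_cancel₀ _ hx.ne'] at h
    linarith

/-- The geometric distribution on `ℕ` with mean `K` has total mass `1`. -/
theorem hasSum_geometric_of_mean {K : ℝ} (hK : 0 ≤ K) :
    HasSum (fun n : ℕ => (1 + K)⁻¹ * (K / (1 + K)) ^ n) 1 := by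
  have h1 : 0 < 1 + K := by linarith
  have h := (hasSum_geometric_of_lt_one (div_nonneg hK h1.le)
    ((div_lt_one h1).2 (by linarith))).mul_left (1 + K)⁻¹
  have h2 : 1 - K / (1 + K) = (1 + K)⁻¹ := by
    field_simp
    ring
  rwa [h2, inv_inv, inv_mul_cancel₀ h1.ne'] at h

/-- Maximum-entropy bound: for a probability distribution `p` on ℕ with mean `K`,
the Shannon entropy `−∑ p n · log (p n)` is at most `(1+K)·log(1+K) − K·log K`
(with the convention `0 · log 0 = 0`, automatic since `Real.log 0 = 0`). -/
theorem shannon_entropy_le_of_fixed_mean (p : ℕ → ℝ) (K : ℝ)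
    (hp : ∀ n, 0 ≤ p n)
    (hsum : HasSum p 1)
    (hmean : HasSum (fun n : ℕ => (n : ℝ) * p n) K)
    (hent : Summable (fun n : ℕ => -(p n * Real.log (p n)))) :
    (∑' n : ℕ, -(p n * Real.log (p n))) ≤
      (1 + K) * Real.log (1 + K) - K * Real.log K := by
  have hnn : ∀ n : ℕ, 0 ≤ (n : ℝ) * p n := fun n => mul_nonneg n.cast_nonneg (hp n)
  rcases (hmean.nonneg hnn).eq_or_lt with rfl | hK
  · have h0 : ∀ n ≠ 0, p n = 0 := fun n hn => by
      simpa [hn] using congrFun ((hasSum_zero_iff_of_nonneg hnn).1 hmean) n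
    have h1 : p 0 = 1 := (hasSum_single 0 h0).unique hsum
    have h : ∀ n, -(p n * Real.log (p n)) = 0 := fun n => by
      rcases eq_or_ne n 0 with rfl | hn
      · simp [h1]
      · simp [h0 n hn]
    simp [h]
  · have h1 : 0 < 1 + K := by linarith
    have hlog : ∀ n : ℕ, Real.log ((1 + K)⁻¹ * (K / (1 + K)) ^ n) =
        -Real.log (1 + K) + n * (Real.log K - Real.log (1 + K)) := fun n => by
      rw [Real.log_mul (by positivity) (by positivity), Real.log_inv, Real.log_pow,
        Real.log_div hK.ne' h1.ne']
    have hbound := ((hsum.mul_left (Real.log (1 + K))).add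
      (hmean.mul_left (Real.log (1 + K) - Real.log K))).add
        ((hasSum_geometric_of_mean hK.le).sub hsum)
    refine (hasSum_le (fun n => ?_) hent.hasSum hbound).trans_eq (by ring)
    have h := neg_mul_log_le_neg_mul_log_add_sub (hp n)
      (show 0 < (1 + K)⁻¹ * (K / (1 + K)) ^ n by positivity)
    rw [hlog] at h
    linarith
end

section
/- Let E : Fin 3 → ℝ, let p : Fin 3 → ℝ satisfy p₁ + p₂ + p₃ = 1, and set a₀ := ∑_i p_i E_i. Then for every t ∈ ℝ, ∑_i p_i (E_i − a₀)·exp(−iE_i t) = −2i·∑_{i<j} p_i p_j (E_i − E_j)·exp(−i(E_i + E_j)t/2)·sin((E_i − E_j)t/2), where the sum on the right runs over the three unordered pairs i < j in {1,2,3}. -/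
/-- The difference of two phases as a mean phase times a sine. -/
theorem exp_neg_I_mul_sub_exp_neg_I_mul (x y t : ℝ) :
    Complex.exp (-Complex.I * x * t) - Complex.exp (-Complex.I * y * t) =
      (-2) * Complex.I * (Complex.exp (-Complex.I * ((x + y : ℝ)) * t / 2) *
        (Real.sin ((x - y) * t / 2) : ℂ)) := by
  have hx : -Complex.I * x * t = -Complex.I * ((x + y : ℝ)) * t / 2 +
      -(((x - y) * t / 2 : ℝ) : ℂ) * Complex.I := by
    push_cast; ring
  have hy : -Complex.I * y * t = -Complex.I * ((x + y : ℝ)) * t / 2 +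
      (((x - y) * t / 2 : ℝ) : ℂ) * Complex.I := by
    push_cast; ring
  rw [hx, hy, Complex.exp_add, Complex.exp_add, Complex.ofReal_sin, Complex.sin]
  linear_combination (Complex.exp (-Complex.I * ((x + y : ℝ)) * t / 2) *
    (Complex.exp (-(((x - y) * t / 2 : ℝ) : ℂ) * Complex.I) -
      Complex.exp ((((x - y) * t / 2 : ℝ) : ℂ) * Complex.I))) * Complex.I_sq


/-- The first qutrit Krylov amplitude identity (times `b₁`): with `∑ p_i = 1`
and `a₀ = ∑ p_i E_i`,
`∑_i p_i(E_i − a₀)e^{−iE_it} = −2i ∑_{i<j} p_i p_j (E_i−E_j) e^{−i(E_i+E_j)t/2} sin((E_i−E_j)t/2)`. -/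
theorem qutrit_first_amplitude_identity (p E : Fin 3 → ℝ) (hp : ∑ i, p i = 1)
    (t : ℝ) :
    let a₀ : ℝ := ∑ i, p i * E i
    (∑ i, ((p i * (E i - a₀) : ℝ) : ℂ) * Complex.exp (-Complex.I * E i * t)) =
      (-2) * Complex.I *
        ∑ i, ∑ j ∈ Finset.Ioi i,
          ((p i * p j * (E i - E j) : ℝ) : ℂ) *
            Complex.exp (-Complex.I * ((E i + E j : ℝ)) * t / 2) *
            (Real.sin ((E i - E j) * t / 2) : ℂ) := by
  intro a₀
  have hsum : (p 0 : ℂ) + p 1 + p 2 = 1 := by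
    rw [Fin.sum_univ_three] at hp
    exact_mod_cast hp
  have h₀ : Finset.Ioi (0 : Fin 3) = {1, 2} := by decide
  have h₁ : Finset.Ioi (1 : Fin 3) = {2} := by decide
  have h₂ : Finset.Ioi (2 : Fin 3) = ∅ := by decide
  have h12 : (1 : Fin 3) ∉ ({2} : Finset (Fin 3)) := by decide
  have h01 := exp_neg_I_mul_sub_exp_neg_I_mul (E 0) (E 1) t
  have h02 := exp_neg_I_mul_sub_exp_neg_I_mul (E 0) (E 2) t
  have h12' := exp_neg_I_mul_sub_exp_neg_I_mul (E 1) (E 2) t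
  simp only [a₀, Fin.sum_univ_three, h₀, h₁, h₂, Finset.sum_insert h12, Finset.sum_singleton,
    Finset.sum_empty, Complex.ofReal_mul, Complex.ofReal_sub, Complex.ofReal_add] at h01 h02 h12' ⊢
  linear_combination (p 0 * p 1 * (E 0 - E 1) : ℂ) * h01 + (p 0 * p 2 * (E 0 - E 2) : ℂ) * h02 +
    (p 1 * p 2 * (E 1 - E 2) : ℂ) * h12' -
    (p 0 * E 0 * Complex.exp (-Complex.I * E 0 * t) +
      p 1 * E 1 * Complex.exp (-Complex.I * E 1 * t) +
      p 2 * E 2 * Complex.exp (-Complex.I * E 2 * t)) * hsum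
end
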